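/- Let f : ℂ → ℂ^N be holomorphic and nowhere vanishing, with P₊f nowhere vanishing, and set g = |P₊f|²/|f|². Then the Gaussian curvature K = −(4/g) ∂∂̄ ln g of the surface built from the holomorphic map satisfies, at every point of ℂ, K = 4 ( 2 − |P₊²f|² |f|² / |P₊f|⁴ ). -/

import Mathlib

open Complex Matrix

/-- Wirtinger derivative ∂ = (∂/∂ζ₁ − i ∂/∂ζ₂)/2 of a map ℂ → ℂ. -/
noncomputable def wD (f : ℂ → ℂ) (z : ℂ) : ℂ :=
  (fderiv ℝ f z 1 - Complex.I * fderiv ℝ f z Complex.I) / 2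

/-- Anti-Wirtinger derivative ∂̄ = (∂/∂ζ₁ + i ∂/∂ζ₂)/2 of a map ℂ → ℂ. -/
noncomputable def wDbar (f : ℂ → ℂ) (z : ℂ) : ℂ :=
  (fderiv ℝ f z 1 + Complex.I * fderiv ℝ f z Complex.I) / 2

/-- Componentwise Wirtinger derivative for vector-valued maps. -/
noncomputable def wDV {N : ℕ} (f : ℂ → Fin N → ℂ) (z : ℂ) : Fin N → ℂ :=
  fun i => wD (fun w => f w i) z

/-- Componentwise anti-Wirtinger derivative for vector-valued maps. -/
noncomputable def wDbarV {N : ℕ} (f : ℂ → Fin N → ℂ) (z : ℂ) : Fin N → ℂ :=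
  fun i => wDbar (fun w => f w i) z

/-- Hermitian inner product a†·b = Σᵢ āᵢ bᵢ on ℂ^N. -/
noncomputable def herm {N : ℕ} (a b : Fin N → ℂ) : ℂ :=
  ∑ i, (starRingEnd ℂ) (a i) * b i

/-- Squared norm |a|² as a real number. -/
noncomputable def nsq {N : ℕ} (a : Fin N → ℂ) : ℝ :=
  ∑ i, Complex.normSq (a i)

/-- The operator P₊ g = ∂g − g (g†·∂g)/|g|². -/
noncomputable def Pp {N : ℕ} (g : ℂ → Fin N → ℂ) : ℂ → Fin N → ℂ :=
  fun z i => wDV g z i - g z i * (herm (g z) (wDV g z) / herm (g z) (g z))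

/-- Iterates of P₊ : P₊⁰ g = g, P₊^{k+1} g = P₊ (P₊^k g). -/
noncomputable def PpIter {N : ℕ} (g : ℂ → Fin N → ℂ) : ℕ → (ℂ → Fin N → ℂ)
  | 0 => g
  | k + 1 => Pp (PpIter g k)

/-- The projector P(V) = V ⊗ V† / |V|². -/
noncomputable def proj {N : ℕ} (V : ℂ → Fin N → ℂ) (z : ℂ) : Matrix (Fin N) (Fin N) ℂ :=
  fun i j => V z i * (starRingEnd ℂ) (V z j) / herm (V z) (V z)

/-- Entrywise Wirtinger derivative for matrix-valued maps. -/
noncomputable def wDM {N : ℕ} (M : ℂ → Matrix (Fin N) (Fin N) ℂ) (z : ℂ) :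
    Matrix (Fin N) (Fin N) ℂ :=
  fun i j => wD (fun w => M w i j) z

/-- Entrywise anti-Wirtinger derivative for matrix-valued maps. -/
noncomputable def wDbarM {N : ℕ} (M : ℂ → Matrix (Fin N) (Fin N) ℂ) (z : ℂ) :
    Matrix (Fin N) (Fin N) ℂ :=
  fun i j => wDbar (fun w => M w i j) z

/-- `f` is real-differentiable at `z` with `∂f = a` and `∂̄f = b`. -/
def HasWirtingerAt (f : ℂ → ℂ) (a b z : ℂ) : Prop :=
  HasFDerivAt f (a • ContinuousLinearMap.id ℝ ℂ + b • (conjCLE : ℂ →L[ℝ] ℂ)) z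

namespace HasWirtingerAt

variable {f g : ℂ → ℂ} {a b a' b' c z : ℂ}

theorem wD_eq (h : HasWirtingerAt f a b z) : wD f z = a := by
  have h' : fderiv ℝ f z = _ := HasFDerivAt.fderiv h
  simp only [wD, h']
  simp
  linear_combination (-a / 2 + b / 2) * I_sq

theorem wDbar_eq (h : HasWirtingerAt f a b z) : wDbar f z = b := by
  have h' : fderiv ℝ f z = _ := HasFDerivAt.fderiv h
  simp only [wDbar, h']
  simp
  linear_combination (a / 2 - b / 2) * I_sq

theorem congr_deriv (h : HasWirtingerAt f a b z) (ha : a = a') (hb : b = b') :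
    HasWirtingerAt f a' b' z := ha ▸ hb ▸ h

theorem of_hasDerivAt (h : HasDerivAt f a z) : HasWirtingerAt f a 0 z := by
  refine (h.hasFDerivAt.restrictScalars ℝ).congr_fderiv ?_
  ext
  simp [mul_comm]

theorem comp_hasDerivAt {φ : ℂ → ℂ} (hφ : HasDerivAt φ c (f z)) (h : HasWirtingerAt f a b z) :
    HasWirtingerAt (fun w => φ (f w)) (c * a) (c * b) z := by
  refine ((hφ.hasFDerivAt.restrictScalars ℝ).comp z h).congr_fderiv ?_
  ext
  simp
  ring

theorem conj (h : HasWirtingerAt f a b z) :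
    HasWirtingerAt (fun w => (starRingEnd ℂ) (f w)) ((starRingEnd ℂ) b) ((starRingEnd ℂ) a) z := by
  refine ((conjCLE : ℂ →L[ℝ] ℂ).hasFDerivAt.comp z h).congr_fderiv ?_
  ext
  simp
  ring

theorem sub (hf : HasWirtingerAt f a b z) (hg : HasWirtingerAt g a' b' z) :
    HasWirtingerAt (fun w => f w - g w) (a - a') (b - b') z := by
  refine (HasFDerivAt.fun_sub hf hg).congr_fderiv ?_
  ext
  simp
  ring

theorem mul (hf : HasWirtingerAt f a b z) (hg : HasWirtingerAt g a' b' z) :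
    HasWirtingerAt (fun w => f w * g w) (a * g z + f z * a') (b * g z + f z * b') z := by
  refine (HasFDerivAt.mul hf hg).congr_fderiv ?_
  ext
  simp
  ring

theorem div (hf : HasWirtingerAt f a b z) (hg : HasWirtingerAt g a' b' z) (h0 : g z ≠ 0) :
    HasWirtingerAt (fun w => f w / g w) ((a * g z - f z * a') / g z ^ 2)
      ((b * g z - f z * b') / g z ^ 2) z := by
  simp only [div_eq_mul_inv (f _)]
  refine (hf.mul (comp_hasDerivAt (hasDerivAt_inv h0) hg)).congr_deriv ?_ ?_ <;> field_simp <;> ring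

theorem sum {ι : Type*} {s : Finset ι} {F : ι → ℂ → ℂ} {α β : ι → ℂ}
    (h : ∀ i ∈ s, HasWirtingerAt (F i) (α i) (β i) z) :
    HasWirtingerAt (fun w => ∑ i ∈ s, F i w) (∑ i ∈ s, α i) (∑ i ∈ s, β i) z := by
  refine (HasFDerivAt.fun_sum h).congr_fderiv ?_
  ext
  simp [Finset.sum_add_distrib, Finset.sum_mul]

end HasWirtingerAt

section Herm

variable {N : ℕ}

theorem hasWirtingerAt_herm {u v u' v' : ℂ → Fin N → ℂ} {z : ℂ}
    (hu : ∀ i, HasDerivAt (fun w => u w i) (u' z i) z)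
    (hv : ∀ i, HasDerivAt (fun w => v w i) (v' z i) z) :
    HasWirtingerAt (fun w => herm (u w) (v w)) (herm (u z) (v' z)) (herm (u' z) (v z)) z := by
  refine (HasWirtingerAt.sum fun i _ => (HasWirtingerAt.of_hasDerivAt (hu i)).conj.mul
    (HasWirtingerAt.of_hasDerivAt (hv i))).congr_deriv ?_ ?_ <;> simp [herm]

theorem herm_sub_left (a b c : Fin N → ℂ) : herm (a - b) c = herm a c - herm b c := by
  simp [herm, sub_mul]

theorem herm_sub_right (a b c : Fin N → ℂ) : herm a (b - c) = herm a b - herm a c := by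
  simp [herm, mul_sub]

theorem herm_smul_left (s : ℂ) (a b : Fin N → ℂ) :
    herm (s • a) b = (starRingEnd ℂ) s * herm a b := by
  simp [herm, Finset.mul_sum, mul_assoc]

theorem herm_smul_right (s : ℂ) (a b : Fin N → ℂ) : herm a (s • b) = s * herm a b := by
  simp [herm, Finset.mul_sum, mul_left_comm]

theorem conj_herm (a b : Fin N → ℂ) : (starRingEnd ℂ) (herm a b) = herm b a := by
  simp [herm, mul_comm]

theorem ofReal_nsq (a : Fin N → ℂ) : (nsq a : ℂ) = herm a a := by
  simp [herm, nsq, normSq_eq_conj_mul_self]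

theorem nsq_pos {a : Fin N → ℂ} (ha : a ≠ 0) : 0 < nsq a := by
  obtain ⟨i, hi⟩ := Function.ne_iff.mp ha
  exact Finset.sum_pos' (fun j _ => normSq_nonneg _) ⟨i, Finset.mem_univ i, normSq_pos.mpr hi⟩

theorem herm_self_ne_zero {a : Fin N → ℂ} (ha : a ≠ 0) : herm a a ≠ 0 := by
  rw [← ofReal_nsq]
  exact_mod_cast (nsq_pos ha).ne'

theorem Pp_apply (g : ℂ → Fin N → ℂ) (z : ℂ) :
    Pp g z = wDV g z - (herm (g z) (wDV g z) / herm (g z) (g z)) • g z := by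
  ext i
  simp [Pp, mul_comm]

theorem herm_Pp_self (g : ℂ → Fin N → ℂ) (z : ℂ) (h : g z ≠ 0) :
    herm (Pp g z) (Pp g z) = herm (wDV g z) (wDV g z) -
      herm (g z) (wDV g z) * herm (wDV g z) (g z) / herm (g z) (g z) := by
  have h0 := herm_self_ne_zero h
  simp only [Pp_apply, herm_sub_left, herm_sub_right, herm_smul_left, herm_smul_right, map_div₀,
    conj_herm]
  field_simp
  ring

variable {f : ℂ → Fin N → ℂ}

theorem hasDerivAt_wDV (hf : ∀ i, Differentiable ℂ fun z => f z i) (z : ℂ) (i : Fin N) :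
    HasDerivAt (fun w => f w i) (wDV f z i) z := by
  have h := (hf i z).hasDerivAt
  rwa [← (HasWirtingerAt.of_hasDerivAt h).wD_eq] at h

theorem differentiable_wDV (hf : ∀ i, Differentiable ℂ fun z => f z i) (i : Fin N) :
    Differentiable ℂ fun z => wDV f z i := by
  have h : (fun z => wDV f z i) = deriv fun z => f z i :=
    funext fun z => (hasDerivAt_wDV hf z i).deriv.symm
  rw [h]
  exact (hf i).deriv

theorem wDV_Pp (hf : ∀ i, Differentiable ℂ fun z => f z i) (z : ℂ) (h0 : f z ≠ 0) :
    wDV (Pp f) z = wDV (wDV f) z - (herm (f z) (wDV f z) / herm (f z) (f z)) • wDV f z -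
      ((herm (f z) (wDV (wDV f) z) * herm (f z) (f z) - herm (f z) (wDV f z) ^ 2) /
        herm (f z) (f z) ^ 2) • f z := by
  have d := hasDerivAt_wDV hf z
  have d' := hasDerivAt_wDV (differentiable_wDV hf) z
  ext i
  have h := ((HasWirtingerAt.of_hasDerivAt (d' i)).sub ((HasWirtingerAt.of_hasDerivAt (d i)).mul
    ((hasWirtingerAt_herm d d').div (hasWirtingerAt_herm d d) (herm_self_ne_zero h0)))).wD_eq
  refine h.trans ?_
  simp
  ring

/-- The Gram determinant of `f` and `∂f`. -/
noncomputable def gramDet (f : ℂ → Fin N → ℂ) (z : ℂ) : ℂ :=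
  herm (f z) (f z) * herm (wDV f z) (wDV f z) - herm (f z) (wDV f z) * herm (wDV f z) (f z)

theorem herm_Pp_self_eq_gramDet_div (z : ℂ) (h : f z ≠ 0) :
    herm (Pp f z) (Pp f z) = gramDet f z / herm (f z) (f z) := by
  have h0 := herm_self_ne_zero h
  rw [herm_Pp_self f z h, gramDet]
  field_simp

theorem hasWirtingerAt_gramDet (hf : ∀ i, Differentiable ℂ fun z => f z i) (z : ℂ) :
    HasWirtingerAt (gramDet f)
      (herm (f z) (f z) * herm (wDV f z) (wDV (wDV f) z) -
        herm (wDV f z) (f z) * herm (f z) (wDV (wDV f) z))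
      (herm (f z) (f z) * herm (wDV (wDV f) z) (wDV f z) -
        herm (f z) (wDV f z) * herm (wDV (wDV f) z) (f z)) z := by
  have d := hasDerivAt_wDV hf z
  have d' := hasDerivAt_wDV (differentiable_wDV hf) z
  refine (((hasWirtingerAt_herm d d).mul (hasWirtingerAt_herm d' d')).sub
    ((hasWirtingerAt_herm d d').mul (hasWirtingerAt_herm d' d))).congr_deriv ?_ ?_ <;> ring

theorem gramDet_ne_zero (z : ℂ) (h : f z ≠ 0) (hP : Pp f z ≠ 0) : gramDet f z ≠ 0 := fun h0 =>
  herm_self_ne_zero hP <| by rw [herm_Pp_self_eq_gramDet_div z h, h0, zero_div]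

theorem ofReal_nsq_Pp_div (z : ℂ) (h : f z ≠ 0) :
    ((nsq (Pp f z) / nsq (f z) : ℝ) : ℂ) =
      gramDet f z / (herm (f z) (f z) * herm (f z) (f z)) := by
  rw [ofReal_div, ofReal_nsq, ofReal_nsq, herm_Pp_self_eq_gramDet_div z h, div_div]

theorem wDbar_log_nsq_div (hf : ∀ i, Differentiable ℂ fun z => f z i)
    (hf0 : ∀ z, f z ≠ 0) (hPf0 : ∀ z, Pp f z ≠ 0) (z : ℂ) :
    wDbar (fun u => (Real.log (nsq (Pp f u) / nsq (f u)) : ℂ)) z =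
      (herm (f z) (f z) * herm (wDV (wDV f) z) (wDV f z) -
        herm (f z) (wDV f z) * herm (wDV (wDV f) z) (f z)) / gramDet f z -
      (herm (wDV f z) (f z) / herm (f z) (f z) + herm (wDV f z) (f z) / herm (f z) (f z)) := by
  have hpos : ∀ u, 0 < nsq (Pp f u) / nsq (f u) := fun u =>
    div_pos (nsq_pos (hPf0 u)) (nsq_pos (hf0 u))
  have hlog : (fun u => (Real.log (nsq (Pp f u) / nsq (f u)) : ℂ)) =
      fun u => Complex.log (gramDet f u / (herm (f u) (f u) * herm (f u) (f u))) :=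
    funext fun u => by rw [ofReal_log (hpos u).le, ofReal_nsq_Pp_div u (hf0 u)]
  have hslit : gramDet f z / (herm (f z) (f z) * herm (f z) (f z)) ∈ slitPlane := by
    rw [← ofReal_nsq_Pp_div z (hf0 z)]
    exact ofReal_mem_slitPlane.mpr (hpos z)
  have hA := herm_self_ne_zero (hf0 z)
  have hD := gramDet_ne_zero z (hf0 z) (hPf0 z)
  have d := hasDerivAt_wDV hf z
  have hAW := hasWirtingerAt_herm d d
  rw [hlog, (HasWirtingerAt.comp_hasDerivAt
    (f := fun u => gramDet f u / (herm (f u) (f u) * herm (f u) (f u))) (hasDerivAt_log hslit)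
    ((hasWirtingerAt_gramDet hf z).div (hAW.mul hAW) (mul_ne_zero hA hA))).wDbar_eq]
  field_simp

theorem wD_wDbar_log_nsq_div (hf : ∀ i, Differentiable ℂ fun z => f z i)
    (hf0 : ∀ z, f z ≠ 0) (hPf0 : ∀ z, Pp f z ≠ 0) (z : ℂ) :
    wD (fun w => wDbar (fun u => (Real.log (nsq (Pp f u) / nsq (f u)) : ℂ)) w) z =
      ((herm (f z) (f z) * herm (wDV (wDV f) z) (wDV (wDV f) z) -
          herm (f z) (wDV (wDV f) z) * herm (wDV (wDV f) z) (f z)) * gramDet f z -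
        (herm (f z) (f z) * herm (wDV (wDV f) z) (wDV f z) -
          herm (f z) (wDV f z) * herm (wDV (wDV f) z) (f z)) *
        (herm (f z) (f z) * herm (wDV f z) (wDV (wDV f) z) -
          herm (wDV f z) (f z) * herm (f z) (wDV (wDV f) z))) / gramDet f z ^ 2 -
      2 * gramDet f z / herm (f z) (f z) ^ 2 := by
  have hA := herm_self_ne_zero (hf0 z)
  have hD := gramDet_ne_zero z (hf0 z) (hPf0 z)
  have d := hasDerivAt_wDV hf z
  have d' := hasDerivAt_wDV (differentiable_wDV hf) z
  have d'' := hasDerivAt_wDV (differentiable_wDV (differentiable_wDV hf)) z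
  have hB := (hasWirtingerAt_herm d' d).div (hasWirtingerAt_herm d d) hA
  simp only [wDbar_log_nsq_div hf hf0 hPf0]
  have hnum := ((hasWirtingerAt_herm d d).mul (hasWirtingerAt_herm d'' d')).sub
    ((hasWirtingerAt_herm d d').mul (hasWirtingerAt_herm d'' d))
  simp only [← sub_sub]
  rw [(((hnum.div (hasWirtingerAt_gramDet hf z) hD).sub hB).sub hB).wD_eq]
  field_simp
  simp only [gramDet]
  ring

theorem herm_Pp_Pp_self (hf : ∀ i, Differentiable ℂ fun z => f z i) (z : ℂ)
    (h0 : f z ≠ 0) (hP : Pp f z ≠ 0) :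
    herm (Pp (Pp f) z) (Pp (Pp f) z) * herm (f z) (f z) * gramDet f z =
      (herm (f z) (f z) * herm (wDV (wDV f) z) (wDV (wDV f) z) -
          herm (f z) (wDV (wDV f) z) * herm (wDV (wDV f) z) (f z)) * gramDet f z -
        (herm (f z) (f z) * herm (wDV (wDV f) z) (wDV f z) -
          herm (f z) (wDV f z) * herm (wDV (wDV f) z) (f z)) *
        (herm (f z) (f z) * herm (wDV f z) (wDV (wDV f) z) -
          herm (wDV f z) (f z) * herm (f z) (wDV (wDV f) z)) := by
  have hA := herm_self_ne_zero h0
  have hD := gramDet_ne_zero z h0 hP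
  rw [herm_Pp_self _ z hP, herm_Pp_self_eq_gramDet_div z h0, wDV_Pp hf z h0, Pp_apply f z]
  simp only [herm_sub_left, herm_sub_right, herm_smul_left, herm_smul_right, map_div₀, map_sub,
    map_mul, map_pow, conj_herm]
  field_simp
  simp only [gramDet]
  ring

end Herm

/-- For `g = |P₊f|²/|f|²`, the Gaussian curvature
`K = −(4/g) ∂∂̄ ln g` satisfies `K = 4(2 − |P₊²f|²|f|²/|P₊f|⁴)`. -/
theorem stmt_9 {N : ℕ} (f : ℂ → Fin N → ℂ)
    (hf : ∀ i, Differentiable ℂ fun z => f z i)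
    (hf0 : ∀ z, f z ≠ 0) (hPf0 : ∀ z, Pp f z ≠ 0) :
    ∀ ζ : ℂ,
      -(4 / ((nsq (Pp f ζ) / nsq (f ζ) : ℝ) : ℂ)) *
        wD (fun w => wDbar (fun u => (Real.log (nsq (Pp f u) / nsq (f u)) : ℂ)) w) ζ =
      4 * (2 - ((nsq (Pp (Pp f) ζ) * nsq (f ζ) / (nsq (Pp f ζ)) ^ 2 : ℝ) : ℂ)) := by
  intro ζ
  have hA := herm_self_ne_zero (hf0 ζ)
  have hD := gramDet_ne_zero ζ (hf0 ζ) (hPf0 ζ)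
  rw [wD_wDbar_log_nsq_div hf hf0 hPf0, ofReal_nsq_Pp_div ζ (hf0 ζ),
    ← herm_Pp_Pp_self hf ζ (hf0 ζ) (hPf0 ζ)]
  simp only [ofReal_div, ofReal_mul, ofReal_pow, ofReal_nsq,
    herm_Pp_self_eq_gramDet_div ζ (hf0 ζ)]
  field_simp
  ring
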